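/- Let x ∈ ℤ_{-τ} with x ∉ (-τ)·ℤ_{-τ} (equivalently, the (-τ)-expansion of x has digit 1 at position 0). Then x + 1/τ ∈ ℤ_{-τ} and no element of ℤ_{-τ} lies in the open interval (x, x + 1/τ); that is, x + 1/τ is the (-τ)-integer immediately following x. -/

import Mathlib

/-- The Ito–Sadahiro transformation `T_{-β}` on `[l_β, r_β)`, where
`l_β = -β/(β+1)` and `r_β = 1/(β+1)`. -/
noncomputable def negT (β : ℝ) (x : ℝ) : ℝ :=
  -β * x - (⌊-β * x - (-β / (β + 1))⌋ : ℝ)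

/-- `Fin(-β)`: reals `x` such that `(-β)^k * x ∈ (l_β, r_β)` for some `k : ℤ`
and some iterate of `T_{-β}` sends it to `0`. -/
def negFin (β : ℝ) (x : ℝ) : Prop :=
  ∃ (k : ℤ) (n : ℕ), ((-β) ^ k * x ∈ Set.Ioo (-β / (β + 1)) (1 / (β + 1))) ∧
    (negT β)^[n] ((-β) ^ k * x) = 0

/-- The set `ℤ_{-β}` of `(-β)`-integers. -/
def negInt (β : ℝ) (x : ℝ) : Prop :=
  x = 0 ∨ ∃ (N : ℕ) (y : ℝ), y ∈ Set.Ioo (-β / (β + 1)) (1 / (β + 1)) ∧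
    x = (-β) ^ (N + 1) * y ∧ (negT β)^[N + 1] y = 0

/-- The `(-β)`-digit `d_{i+1}(y)` of `y ∈ [l_β, r_β)` (indices shifted so that
`negDigit β y i` is the digit `d_{i+1}(y)`). -/
noncomputable def negDigit (β : ℝ) (y : ℝ) (i : ℕ) : ℤ :=
  ⌊-β * ((negT β)^[i] y) - (-β / (β + 1))⌋

/-- The golden ratio `τ = (1+√5)/2`. -/
noncomputable def tau : ℝ := (1 + Real.sqrt 5) / 2

/-- The Rényi transformation `T_β` on `[0,1)`. -/
noncomputable def renyiT (β : ℝ) (x : ℝ) : ℝ := β * x - (⌊β * x⌋ : ℝ)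

/-- The set `ℤ_β` of (nonnegative) `β`-integers. -/
def posInt (β : ℝ) (x : ℝ) : Prop :=
  x = 0 ∨ ∃ N : ℕ, (β ^ (-(N + 1 : ℤ)) * x ∈ Set.Ico (0 : ℝ) 1) ∧
    (renyiT β)^[N + 1] (β ^ (-(N + 1 : ℤ)) * x) = 0

lemma tau_sq : tau ^ 2 = tau + 1 := by
  have h : Real.sqrt 5 ^ 2 = 5 := Real.sq_sqrt (by norm_num)
  unfold tau
  linarith

lemma tau_bounds : 1.618 < tau ∧ tau < 1.6181 := by
  have h : Real.sqrt 5 ^ 2 = 5 := Real.sq_sqrt (by norm_num)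
  have h0 : 0 ≤ Real.sqrt 5 := Real.sqrt_nonneg 5
  unfold tau
  constructor <;> nlinarith

lemma tau_pos : 0 < tau := by linarith [tau_bounds.1]

lemma one_div_tau : 1 / tau = tau - 1 := by
  rw [div_eq_iff tau_pos.ne']
  linarith [tau_sq]

lemma neg_tau_div_tau_add_one : -tau / (tau + 1) = 1 - tau := by
  rw [div_eq_iff (by linarith [tau_pos])]
  linarith [tau_sq]

lemma one_div_tau_add_one : 1 / (tau + 1) = 2 - tau := by
  rw [div_eq_iff (by linarith [tau_pos])]
  linarith [tau_sq]

/-- `IsTauConj x c` says that `x = a + b τ` lies in `ℤ[τ]` and that `c = a + b (1 - τ)` is its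
Galois conjugate. -/
def IsTauConj (x c : ℝ) : Prop :=
  ∃ a b : ℤ, x = a + b * tau ∧ c = a + b * (1 - tau)

namespace IsTauConj

lemma intCast (d : ℤ) : IsTauConj d d := ⟨d, 0, by simp, by simp⟩

lemma one_div_tau : IsTauConj (1 / tau) (-tau) :=
  ⟨-1, 1, by rw [_root_.one_div_tau]; push_cast; ring, by push_cast; ring⟩

lemma add {x c y e : ℝ} (hx : IsTauConj x c) (hy : IsTauConj y e) : IsTauConj (x + y) (c + e) := by
  obtain ⟨a, b, rfl, rfl⟩ := hx
  obtain ⟨a', b', rfl, rfl⟩ := hy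
  exact ⟨a + a', b + b', by push_cast; ring, by push_cast; ring⟩

lemma neg {x c : ℝ} (hx : IsTauConj x c) : IsTauConj (-x) (-c) := by
  obtain ⟨a, b, rfl, rfl⟩ := hx
  exact ⟨-a, -b, by push_cast; ring, by push_cast; ring⟩

lemma sub {x c y e : ℝ} (hx : IsTauConj x c) (hy : IsTauConj y e) : IsTauConj (x - y) (c - e) := by
  simpa [sub_eq_add_neg] using hx.add hy.neg

lemma neg_tau_mul {x c : ℝ} (hx : IsTauConj x c) : IsTauConj (-tau * x) (c / tau) := by
  obtain ⟨a, b, rfl, rfl⟩ := hx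
  refine ⟨-b, -(a + b), ?_, ?_⟩
  · push_cast
    linear_combination (-(b : ℝ)) * tau_sq
  · rw [div_eq_iff tau_pos.ne']
    push_cast
    linear_combination (-(a + b : ℝ)) * tau_sq

lemma div_neg_tau {x c : ℝ} (hx : IsTauConj x c) : IsTauConj (x / -tau) (tau * c) := by
  obtain ⟨a, b, rfl, rfl⟩ := hx
  refine ⟨a - b, -a, ?_, ?_⟩
  · rw [div_eq_iff (neg_ne_zero.mpr tau_pos.ne')]
    push_cast
    linear_combination (-(a : ℝ)) * tau_sq
  · push_cast
    linear_combination (-(b : ℝ)) * tau_sq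

lemma neg_tau_pow_mul {x c : ℝ} (hx : IsTauConj x c) (n : ℕ) :
    IsTauConj ((-tau) ^ n * x) (c / tau ^ n) := by
  induction n with
  | zero => simpa using hx
  | succ n ih => simpa [pow_succ', mul_assoc, div_div, mul_comm (tau ^ n)] using ih.neg_tau_mul

lemma div_neg_tau_pow {x c : ℝ} (hx : IsTauConj x c) (n : ℕ) :
    IsTauConj (x / (-tau) ^ n) (tau ^ n * c) := by
  induction n with
  | zero => simpa using hx
  | succ n ih =>
    have h := ih.div_neg_tau
    rwa [div_div, ← pow_succ, ← mul_assoc, ← pow_succ'] at h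

/-- The only element of `ℤ[τ] ∩ (0, 1/τ]` whose conjugate is smaller than `τ²` in absolute value
is `1/τ`. -/
lemma eq_one_div_tau {x c : ℝ} (h : IsTauConj x c) (hx0 : 0 < x) (hx1 : x ≤ tau - 1)
    (hc0 : -(tau + 1) < c) (hc1 : c < tau + 1) : x = tau - 1 ∧ c = -tau := by
  obtain ⟨a, b, rfl, rfl⟩ := h
  obtain ⟨ht0, ht1⟩ := tau_bounds
  have hb0 : (-2 : ℝ) < b := by nlinarith
  have hb1 : (b : ℝ) < 2 := by nlinarith
  have hb0' : -2 < b := by exact_mod_cast hb0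
  have hb1' : b < 2 := by exact_mod_cast hb1
  obtain rfl | rfl | rfl : b = -1 ∨ b = 0 ∨ b = 1 := by lia
  · exfalso
    push_cast at *
    have h1 : (1 : ℝ) < a := by linarith
    have h2 : (a : ℝ) < 2 := by linarith
    norm_cast at h1 h2
    lia
  · exfalso
    push_cast at *
    have h1 : (0 : ℝ) < a := by linarith
    have h2 : (a : ℝ) < 1 := by linarith
    norm_cast at h1 h2
    lia
  · push_cast at *
    have h1 : (-2 : ℝ) < a := by linarith
    have h2 : (a : ℝ) ≤ -1 := by linarith
    norm_cast at h1 h2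
    obtain rfl : a = -1 := by lia
    constructor <;> push_cast <;> ring

end IsTauConj

lemma negT_tau_mem (y : ℝ) : negT tau y ∈ Set.Ico (1 - tau) (2 - tau) := by
  have h1 := Int.floor_le (-tau * y - (1 - tau))
  have h2 := Int.lt_floor_add_one (-tau * y - (1 - tau))
  rw [negT, neg_tau_div_tau_add_one]
  constructor <;> linarith

lemma exists_digit_negT_tau {y : ℝ} (hy : y ∈ Set.Ico (1 - tau) (2 - tau)) :
    ∃ d : ℤ, (d = 0 ∨ d = 1) ∧ negT tau y = -tau * y - d := by
  refine ⟨⌊-tau * y - (1 - tau)⌋, ?_, by rw [negT, neg_tau_div_tau_add_one]⟩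
  obtain ⟨h1, h2⟩ := hy
  have ht := tau_sq
  obtain ⟨ht0, ht1⟩ := tau_bounds
  have hf0 : 0 ≤ ⌊-tau * y - (1 - tau)⌋ := Int.floor_nonneg.mpr (by nlinarith)
  have hf1 : ⌊-tau * y - (1 - tau)⌋ < 2 := Int.floor_lt.mpr (by push_cast; nlinarith)
  lia

lemma exists_conj_of_iterate_negT_eq_zero (n : ℕ) {y : ℝ}
    (hy : y ∈ Set.Ico (1 - tau) (2 - tau)) (h : (negT tau)^[n] y = 0) :
    ∃ c, IsTauConj y c ∧ 0 ≤ c ∧ c ≤ tau ^ 2 * (tau ^ n - 1) := by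
  induction n generalizing y with
  | zero =>
    obtain rfl : y = 0 := h
    exact ⟨0, by simpa using IsTauConj.intCast 0, le_rfl, by simp⟩
  | succ n ih =>
    obtain ⟨c, hc, hc0, hc1⟩ := ih (negT_tau_mem y) h
    obtain ⟨d, hd, hT⟩ := exists_digit_negT_tau hy
    have hd01 : (0 : ℝ) ≤ d ∧ (d : ℝ) ≤ 1 := by
      rcases hd with rfl | rfl <;> norm_num
    have hpos := tau_pos
    refine ⟨tau * (c + d), ?_, mul_nonneg hpos.le (by linarith), ?_⟩
    · convert (hc.add (IsTauConj.intCast d)).div_neg_tau using 1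
      rw [hT]
      field_simp
      ring
    · calc tau * (c + d) ≤ tau * (tau ^ 2 * (tau ^ n - 1) + 1) := by gcongr; exact hd01.2
        _ = tau ^ 2 * (tau ^ (n + 1) - 1) := by
          linear_combination (-tau) * tau_sq

lemma IsTauConj.negT {y c : ℝ} (h : IsTauConj y c) (hy : y ∈ Set.Ico (1 - tau) (2 - tau)) :
    ∃ c', IsTauConj (negT tau y) c' ∧ c' ≤ c / tau ∧ c / tau - 1 ≤ c' ∧
      (_root_.negT tau y = 1 - tau → c' ≤ c / tau - 1) := by
  obtain ⟨d, hd, hT⟩ := exists_digit_negT_tau hy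
  refine ⟨c / tau - d, hT ▸ h.neg_tau_mul.sub (IsTauConj.intCast d), ?_, ?_, fun hl ↦ ?_⟩
  · rcases hd with rfl | rfl <;> norm_num
  · rcases hd with rfl | rfl <;> norm_num
  · rcases hd with rfl | rfl
    · push_cast at hT
      have := hy.2
      have := tau_sq
      have := tau_bounds.1
      nlinarith
    · simp

lemma IsTauConj.iterate_negT (n : ℕ) {y c : ℝ} (h : IsTauConj y c)
    (hy : y ∈ Set.Ico (1 - tau) (2 - tau)) (hc : -(tau + 1) < c) :
    ∃ c', IsTauConj ((_root_.negT tau)^[n] y) c' ∧ -(tau + 1) < c' ∧ c' ≤ c / tau ^ n := by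
  induction n with
  | zero => exact ⟨c, h, hc, by simp⟩
  | succ n ih =>
    obtain ⟨e, he, he0, he1⟩ := ih
    have hmem : (_root_.negT tau)^[n] y ∈ Set.Ico (1 - tau) (2 - tau) := by
      cases n with
      | zero => exact hy
      | succ n => rw [Function.iterate_succ_apply']; exact negT_tau_mem _
    obtain ⟨e', he', h1, h2, -⟩ := he.negT hmem
    have hpos := tau_pos
    have hlow : -tau < e / tau := by
      rw [lt_div_iff₀ hpos]
      linarith [tau_sq]
    refine ⟨e', by rwa [Function.iterate_succ_apply'], by linarith, h1.trans ?_⟩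
    rw [pow_succ, ← div_div]
    gcongr

/-- If `y ∈ [l, r)` lies in `ℤ[τ]` and its conjugate is small enough, the orbit of `y` under
`T_{-τ}` reaches `0` after `n + 1` steps. -/
lemma IsTauConj.iterate_negT_eq_zero (n : ℕ) {y c : ℝ} (h : IsTauConj y c)
    (hy : y ∈ Set.Ico (1 - tau) (2 - tau)) (hc : 0 ≤ c) (hc' : c / tau ^ (n + 1) < tau + 1) :
    (_root_.negT tau)^[n + 1] y = 0 := by
  have hpos := tau_pos
  obtain ⟨e, he, he0, he1⟩ := h.iterate_negT n hy (by linarith)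
  have hmem : (_root_.negT tau)^[n] y ∈ Set.Ico (1 - tau) (2 - tau) := by
    cases n with
    | zero => exact hy
    | succ n => rw [Function.iterate_succ_apply']; exact negT_tau_mem _
  obtain ⟨e', he', h1, h2, h3⟩ := he.negT hmem
  have hup : e / tau < tau + 1 := by
    refine lt_of_le_of_lt ?_ hc'
    rw [pow_succ, ← div_div]
    gcongr
  have hlow : -tau < e / tau := by
    rw [lt_div_iff₀ hpos]
    linarith [tau_sq]
  rw [Function.iterate_succ_apply']
  obtain ⟨hl, hr⟩ := negT_tau_mem ((_root_.negT tau)^[n] y)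
  obtain ⟨ht0, ht1⟩ := tau_bounds
  rcases lt_trichotomy (_root_.negT tau ((_root_.negT tau)^[n] y)) 0 with hneg | h0 | hp
  · exfalso
    obtain ⟨hx, hce⟩ :=
      he'.neg.eq_one_div_tau (by linarith) (by linarith) (by linarith) (by linarith)
    have := h3 (by linarith)
    linarith
  · exact h0
  · exfalso
    obtain ⟨hx, -⟩ := he'.eq_one_div_tau hp (by linarith) (by linarith) (by linarith)
    linarith

/-- `ℤ_{-τ}` is the cut-and-project set of the elements of `ℤ[τ]` with conjugate in `[0, τ²)`. -/
lemma negInt_tau_iff (x : ℝ) : negInt tau x ↔ ∃ c, IsTauConj x c ∧ 0 ≤ c ∧ c < tau + 1 := by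
  have hpos := tau_pos
  obtain ⟨ht0, ht1⟩ := tau_bounds
  simp only [negInt, neg_tau_div_tau_add_one, one_div_tau_add_one]
  constructor
  · rintro (rfl | ⟨N, y, hy, rfl, hT⟩)
    · exact ⟨0, by simpa using IsTauConj.intCast 0, le_rfl, by linarith⟩
    · obtain ⟨c, hc, hc0, hc1⟩ :=
        exists_conj_of_iterate_negT_eq_zero (N + 1) (Set.Ioo_subset_Ico_self hy) hT
      refine ⟨c / tau ^ (N + 1), hc.neg_tau_pow_mul _, by positivity, ?_⟩
      rw [div_lt_iff₀ (by positivity), ← tau_sq]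
      nlinarith [sq_pos_of_pos hpos]
  · rintro ⟨c, hc, hc0, hc1⟩
    right
    have hr : 0 < 2 - tau := by linarith
    obtain ⟨N, hN⟩ := pow_unbounded_of_one_lt (|x| / (2 - tau)) (by linarith : 1 < tau)
    have hN' : |x| / (2 - tau) < tau ^ (N + 1) :=
      hN.trans (pow_lt_pow_right₀ (by linarith) N.lt_succ_self)
    have habs : |x / (-tau) ^ (N + 1)| < 2 - tau := by
      rw [abs_div, abs_pow, abs_neg, abs_of_pos hpos, div_lt_iff₀ (by positivity), mul_comm]
      rwa [div_lt_iff₀ hr] at hN'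
    have hmem : x / (-tau) ^ (N + 1) ∈ Set.Ioo (1 - tau) (2 - tau) := by
      obtain ⟨h1, h2⟩ := abs_lt.mp habs
      exact ⟨by linarith, h2⟩
    refine ⟨N, _, hmem, ?_, ?_⟩
    · rw [mul_div_cancel₀ _ (pow_ne_zero _ (neg_ne_zero.mpr hpos.ne'))]
    · refine (hc.div_neg_tau_pow (N + 1)).iterate_negT_eq_zero N
        (Set.Ioo_subset_Ico_self hmem) (by positivity) ?_
      rwa [mul_div_cancel_left₀ _ (by positivity)]

/-- If `x ∈ ℤ_{-τ}` with `x ∉ (-τ)·ℤ_{-τ}` (digit `1` at position `0`),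
then `x + 1/τ` is the `(-τ)`-integer immediately following `x`. -/
theorem successor_after_digit_one
    (x : ℝ) (hx : negInt tau x) (hx' : ¬ ∃ z : ℝ, negInt tau z ∧ x = -tau * z) :
    negInt tau (x + 1 / tau) ∧ ∀ w : ℝ, negInt tau w → w ∉ Set.Ioo x (x + 1 / tau) := by
  have hpos := tau_pos
  obtain ⟨c, hc, hc0, hc1⟩ := (negInt_tau_iff x).mp hx
  have hcτ : tau ≤ c := by
    by_contra! hlt
    refine hx' ⟨x / -tau, (negInt_tau_iff _).mpr ⟨_, hc.div_neg_tau, by positivity, ?_⟩, ?_⟩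
    · nlinarith [tau_sq]
    · field_simp
  refine ⟨(negInt_tau_iff _).mpr
    ⟨_, hc.add IsTauConj.one_div_tau, by linarith, by linarith⟩, fun w hw ⟨hw1, hw2⟩ ↦ ?_⟩
  obtain ⟨e, he, he0, he1⟩ := (negInt_tau_iff w).mp hw
  rw [one_div_tau] at hw2
  obtain ⟨h, -⟩ :=
    (he.sub hc).eq_one_div_tau (by linarith) (by linarith) (by linarith) (by linarith)
  linarith
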